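/- arXiv:2506.22130 — 2 statements merged into one kernel-verified Lean document; each statement's English description precedes it below -/
import Mathlib

section
/- Let π : G₁ → G₂ be a discrete admissible cover with G₂ connected. Then the genera g(G₁), g(G₂), the leg counts, and the degree of π satisfy the Riemann–Hurwitz equality: #L(G₁) + 2(g(G₁) − 1) = deg(π) · (#L(G₂) + 2(g(G₂) − 1)) + Σ_{V ∈ V(G₁)} r_π(V), where r_π(V) := val(V) − 2 − d_π(V)·(val(π(V)) − 2) (which vanishes for every vertex V by the definition of discrete admissible cover). -/
open scoped Classical

noncomputable section
/-! ### Discrete graphs and discrete admissible covers -/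

/-- A discrete graph: a finite set of flags with a root map and an involution. -/
structure DiscreteGraph : Type 1 where
  F : Type
  fintypeF : Fintype F
  r : F → F
  ι : F → F
  invol : ∀ x, ι (ι x) = x
  ir : ∀ x, ι (r x) = r x
  r_idem : ∀ x, r (r x) = r x

attribute [instance] DiscreteGraph.fintypeF

namespace DiscreteGraph

variable (G : DiscreteGraph)

/-- Vertices are the elements of the image of the root map. -/
def IsVertex (x : G.F) : Prop := x ∈ Set.range G.r

/-- `x` is a leg: a non-vertex flag fixed by the involution. -/
def IsLeg (x : G.F) : Prop := ¬ G.IsVertex x ∧ G.ι x = x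

/-- `x` is one of the two halves of an edge. -/
def IsEdgeHalf (x : G.F) : Prop := ¬ G.IsVertex x ∧ G.ι x ≠ x

/-- The valency of a vertex: `# r⁻¹(V) - 1`. -/
def valency (v : G.F) : ℤ := ((Finset.univ.filter fun x => G.r x = v).card : ℤ) - 1

/-- The number of legs of the graph. -/
def numLegs : ℕ := (Finset.univ.filter fun x => G.IsLeg x).card

/-- The number of halves of edges of the graph (twice the number of edges). -/
def numEdgeHalves : ℕ := (Finset.univ.filter fun x => G.IsEdgeHalf x).card

/-- The number of vertices of the graph. -/
def numVertices : ℕ := (Finset.univ.filter fun x => G.IsVertex x).card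

/-- The genus `#E - #V + 1` of a connected discrete graph. -/
def genusZ : ℤ := ((G.numEdgeHalves / 2 : ℕ) : ℤ) - (G.numVertices : ℤ) + 1

/-- The adjacency relation generating the connectivity of the graph. -/
def adj : G.F → G.F → Prop := fun x y => y = G.r x ∨ y = G.ι x

/-- A discrete graph is connected when any two flags are related by a chain of
adjacencies. -/
def Connected : Prop := ∀ x y : G.F, Relation.EqvGen G.adj x y

end DiscreteGraph

/-- A map of discrete graphs: a map of flags commuting with the root maps and
the involutions. -/
structure GraphMap (G₁ G₂ : DiscreteGraph) where
  toFun : G₁.F → G₂.F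
  comm_r : ∀ x, G₂.r (toFun x) = toFun (G₁.r x)
  comm_ι : ∀ x, G₂.ι (toFun x) = toFun (G₁.ι x)

/-- A discrete admissible cover: a surjective, non-contracting map of graphs with
a degree assignment satisfying the local balancing condition and the vanishing of
all Riemann–Hurwitz numbers. -/
structure DiscAdmCover (G₁ G₂ : DiscreteGraph) extends GraphMap G₁ G₂ where
  surjective : Function.Surjective toFun
  noncontracting : ∀ x, G₂.IsVertex (toFun x) → G₁.IsVertex x
  d : G₁.F → ℕ
  d_invol : ∀ x, d (G₁.ι x) = d x
  balanced : ∀ V, G₁.IsVertex V → ∀ H', G₂.r H' = toFun V → H' ≠ toFun V →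
      (d V : ℤ) = ∑ h ∈ Finset.univ.filter (fun h => toFun h = H' ∧ G₁.r h = V), (d h : ℤ)
  rh_vanish : ∀ V, G₁.IsVertex V →
      G₁.valency V - 2 = (d V : ℤ) * (G₂.valency (toFun V) - 2)

namespace DiscAdmCover

variable {G₁ G₂ : DiscreteGraph} (π : DiscAdmCover G₁ G₂)

/-- The degree of the cover, computed at a vertex `A` of the target. -/
def degAt (A : G₂.F) : ℤ :=
  ∑ V ∈ Finset.univ.filter (fun V => π.toFun V = A), (π.d V : ℤ)

/-- The Riemann–Hurwitz number of the cover at a vertex of the source. -/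
def rhNum (V : G₁.F) : ℤ :=
  G₁.valency V - 2 - (π.d V : ℤ) * (G₂.valency (π.toFun V) - 2)

end DiscAdmCover

namespace DiscreteGraph

variable (G : DiscreteGraph)

theorem isVertex_r (x : G.F) : G.IsVertex (G.r x) := ⟨x, rfl⟩

variable {G}

theorem IsVertex.r_eq {x : G.F} (hx : G.IsVertex x) : G.r x = x := by
  obtain ⟨y, rfl⟩ := hx
  exact G.r_idem y

theorem IsVertex.ι_eq {x : G.F} (hx : G.IsVertex x) : G.ι x = x := by
  obtain ⟨y, rfl⟩ := hx
  exact G.ir y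

theorem IsEdgeHalf.ι {x : G.F} (hx : G.IsEdgeHalf x) : G.IsEdgeHalf (G.ι x) := by
  refine ⟨fun h => hx.2 ?_, fun h => hx.2 ?_⟩
  · rw [← h.ι_eq, G.invol]
  · rw [G.invol] at h
    exact h.symm

variable (G)

/-- Edge halves come in pairs exchanged by the involution. -/
theorem even_numEdgeHalves : Even G.numEdgeHalves := by
  have h : ∑ x ∈ Finset.univ.filter (fun x => G.IsEdgeHalf x), (1 : ZMod 2) = 0 :=
    Finset.sum_involution (fun x _ => G.ι x) (fun _ _ => by decide)
      (fun x hx _ => (Finset.mem_filter.mp hx).2.2)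
      (fun x hx => Finset.mem_filter.mpr ⟨Finset.mem_univ _, (Finset.mem_filter.mp hx).2.ι⟩)
      (fun x _ => G.invol x)
  rw [Finset.sum_const, nsmul_one, ZMod.natCast_eq_zero_iff_even] at h
  exact h

theorem card_flags : Fintype.card G.F = G.numVertices + G.numLegs + G.numEdgeHalves := by
  have hflags := Finset.card_filter_add_card_filter_not
    (s := (Finset.univ : Finset G.F)) (fun x => G.IsVertex x)
  have hhalves : (Finset.univ.filter fun x => ¬ G.IsVertex x).card =
      G.numLegs + G.numEdgeHalves := by
    rw [← Finset.card_filter_add_card_filter_not (fun x => G.ι x = x),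
      Finset.filter_filter, Finset.filter_filter]
    unfold numLegs numEdgeHalves IsLeg IsEdgeHalf
    congr!
  rw [Finset.card_univ, hhalves, ← add_assoc] at hflags
  exact hflags.symm

theorem sum_card_fiber_r :
    ∑ v ∈ Finset.univ.filter (fun v => G.IsVertex v),
      (Finset.univ.filter fun x => G.r x = v).card = Fintype.card G.F := by
  rw [← Finset.card_univ]
  exact (Finset.card_eq_sum_card_fiberwise fun x _ => by simpa using G.isVertex_r x).symm

/-- The Euler characteristic side of the Riemann–Hurwitz equality, as a sum of local terms. -/
theorem numLegs_add_two_mul_genusZ_sub_one :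
    (G.numLegs : ℤ) + 2 * (G.genusZ - 1) =
      ∑ v ∈ Finset.univ.filter (fun v => G.IsVertex v), (G.valency v - 2) := by
  obtain ⟨k, hk⟩ := G.even_numEdgeHalves
  have hcard := G.card_flags
  have hfiber : (∑ v ∈ Finset.univ.filter (fun v => G.IsVertex v),
      ((Finset.univ.filter fun x => G.r x = v).card : ℤ)) = Fintype.card G.F := by
    exact_mod_cast G.sum_card_fiber_r
  have hV : (Finset.univ.filter fun v => G.IsVertex v).card = G.numVertices := rfl
  simp only [valency, Finset.sum_sub_distrib, Finset.sum_const, nsmul_eq_mul, hfiber, hV, genusZ]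
  omega

end DiscreteGraph

namespace DiscAdmCover

variable {G₁ G₂ : DiscreteGraph} (π : DiscAdmCover G₁ G₂)

theorem isVertex_toFun {V : G₁.F} (hV : G₁.IsVertex V) : G₂.IsVertex (π.toFun V) := by
  rw [← hV.r_eq, ← π.comm_r]
  exact G₂.isVertex_r _

theorem rhNum_eq_zero {V : G₁.F} (hV : G₁.IsVertex V) : π.rhNum V = 0 :=
  sub_eq_zero.mpr (π.rh_vanish V hV)

theorem degAt_ι (x : G₂.F) : π.degAt (G₂.ι x) = π.degAt x := by
  refine Finset.sum_nbij' G₁.ι G₁.ι ?_ ?_ (fun h _ => G₁.invol h) (fun h _ => G₁.invol h)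
    (fun h _ => by rw [π.d_invol])
  · intro h hh
    simp only [Finset.mem_filter, Finset.mem_univ, true_and] at hh ⊢
    rw [← π.comm_ι, hh, G₂.invol]
  · intro h hh
    simp only [Finset.mem_filter, Finset.mem_univ, true_and] at hh ⊢
    rw [← π.comm_ι, hh]

theorem degAt_r (x : G₂.F) : π.degAt (G₂.r x) = π.degAt x := by
  by_cases hx : G₂.IsVertex x
  · rw [hx.r_eq]
  have hmaps : ∀ h ∈ Finset.univ.filter (fun h => π.toFun h = x),
      G₁.r h ∈ Finset.univ.filter (fun V => π.toFun V = G₂.r x) := by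
    intro h hh
    simp only [Finset.mem_filter, Finset.mem_univ, true_and] at hh ⊢
    rw [← π.comm_r, hh]
  unfold degAt
  rw [← Finset.sum_fiberwise_of_maps_to hmaps]
  refine Finset.sum_congr rfl fun V hV => ?_
  have hVx : π.toFun V = G₂.r x := (Finset.mem_filter.mp hV).2
  have hVr : G₂.IsVertex (π.toFun V) := hVx ▸ G₂.isVertex_r x
  rw [Finset.filter_filter]
  exact π.balanced V (π.noncontracting V hVr) x hVx.symm fun h => hx (h ▸ hVr)

/-- The degree does not depend on the flag of a connected target. -/
theorem degAt_eq_of_connected (hconn : G₂.Connected) (x y : G₂.F) : π.degAt x = π.degAt y := by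
  induction hconn x y with
  | rel x y h =>
    rcases h with rfl | rfl
    · exact (π.degAt_r x).symm
    · exact (π.degAt_ι x).symm
  | refl x => rfl
  | symm x y _ ih => exact ih.symm
  | trans x y z _ _ ih₁ ih₂ => exact ih₁.trans ih₂

/-- The sum of `val - 2` over the vertices of the source, grouped along the cover. -/
theorem sum_valency_sub_two :
    ∑ V ∈ Finset.univ.filter (fun V => G₁.IsVertex V), (G₁.valency V - 2) =
      ∑ B ∈ Finset.univ.filter (fun B => G₂.IsVertex B), π.degAt B * (G₂.valency B - 2) := by
  have hmaps : ∀ V ∈ Finset.univ.filter (fun V => G₁.IsVertex V),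
      π.toFun V ∈ Finset.univ.filter (fun B => G₂.IsVertex B) := by
    intro V hV
    simp only [Finset.mem_filter, Finset.mem_univ, true_and] at hV ⊢
    exact π.isVertex_toFun hV
  rw [← Finset.sum_fiberwise_of_maps_to hmaps]
  refine Finset.sum_congr rfl fun B hB => ?_
  have hB' : G₂.IsVertex B := (Finset.mem_filter.mp hB).2
  rw [degAt, Finset.sum_mul, Finset.filter_filter]
  refine Finset.sum_congr (Finset.filter_congr fun V _ => ?_) fun V hV => ?_
  · exact ⟨And.right, fun h => ⟨π.noncontracting V (h ▸ hB'), h⟩⟩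
  · have hVB : π.toFun V = B := (Finset.mem_filter.mp hV).2
    rw [π.rh_vanish V (π.noncontracting V (hVB ▸ hB')), hVB]

end DiscAdmCover

/-- **Riemann–Hurwitz equality** (Statement 0).  For a discrete admissible cover
`π : G₁ → G₂` with `G₂` connected, and any vertex `A` of `G₂` (computing the degree):
`#L(G₁) + 2(g(G₁) − 1) = deg(π)·(#L(G₂) + 2(g(G₂) − 1)) + Σ_{V ∈ V(G₁)} r_π(V)`. -/
theorem riemann_hurwitz_equality (G₁ G₂ : DiscreteGraph) (π : DiscAdmCover G₁ G₂)
    (hconn : G₂.Connected) (A : G₂.F) (hA : G₂.IsVertex A) :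
    (G₁.numLegs : ℤ) + 2 * (G₁.genusZ - 1)
      = π.degAt A * ((G₂.numLegs : ℤ) + 2 * (G₂.genusZ - 1))
        + ∑ V ∈ Finset.univ.filter (fun V => G₁.IsVertex V), π.rhNum V := by
  rw [Finset.sum_eq_zero fun V hV => π.rhNum_eq_zero (Finset.mem_filter.mp hV).2, add_zero,
    G₁.numLegs_add_two_mul_genusZ_sub_one, G₂.numLegs_add_two_mul_genusZ_sub_one,
    π.sum_valency_sub_two, Finset.mul_sum]
  exact Finset.sum_congr rfl fun B _ => by rw [π.degAt_eq_of_connected hconn B A]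
end
end

section
/- Let π : Γ → Δ be a tropical admissible cover and let f be a rational function on Δ. Then f ∘ π is a rational function on Γ and π*div(f) = div(f ∘ π); that is, for every y ∈ Γ, ord_y(f ∘ π) = d_π(y) · ord_{π(y)} f. -/
open scoped Classical

noncomputable section

/-! ## Combinatorial models of metric graphs and their topological realizations -/

/-- A combinatorial model of a metric graph: a finite multigraph with positive
edge lengths. -/
structure CombGraph : Type 1 where
  V : Type
  E : Type
  fintypeV : Fintype V
  fintypeE : Fintype E
  src : E → V
  tgt : E → V
  len : E → ℝ
  len_pos : ∀ e, 0 < len e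

attribute [instance] CombGraph.fintypeV CombGraph.fintypeE

namespace CombGraph

variable (G : CombGraph)

instance : TopologicalSpace G.V := ⊥
instance : TopologicalSpace G.E := ⊥

/-- The disjoint union of the vertices and of the edges seen as real intervals,
before gluing. -/
def Pre : Type := G.V ⊕ (G.E × ℝ)

instance : TopologicalSpace G.Pre := inferInstanceAs (TopologicalSpace (G.V ⊕ (G.E × ℝ)))

/-- The predicate selecting legitimate points: a point of an edge `e` must have its
coordinate in `[0, len e]`. -/
def Ok : G.Pre → Prop
  | Sum.inl _ => True
  | Sum.inr p => 0 ≤ p.2 ∧ p.2 ≤ G.len p.1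

/-- Points of the model before gluing. -/
def PreR : Type := {p : G.Pre // G.Ok p}

instance : TopologicalSpace G.PreR := inferInstanceAs (TopologicalSpace {p : G.Pre // G.Ok p})

/-- The gluing relation: the endpoints of each edge are glued to the corresponding
vertices. -/
inductive Glue : G.PreR → G.PreR → Prop
  | srcGlue (e : G.E) :
      Glue ⟨Sum.inl (G.src e), trivial⟩ ⟨Sum.inr (e, 0), ⟨le_refl 0, (G.len_pos e).le⟩⟩
  | tgtGlue (e : G.E) :
      Glue ⟨Sum.inl (G.tgt e), trivial⟩ ⟨Sum.inr (e, G.len e), ⟨(G.len_pos e).le, le_refl _⟩⟩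

/-- The topological realization of the combinatorial model: the underlying
topological space of the associated metric graph. -/
def Space : Type := Quot G.Glue

instance : TopologicalSpace G.Space := inferInstanceAs (TopologicalSpace (Quot G.Glue))

/-- The point of the realization corresponding to a vertex. -/
def vertexPt (v : G.V) : G.Space := Quot.mk _ ⟨Sum.inl v, trivial⟩

/-- Clamping of a real coordinate into `[0, len e]`. -/
def clamp (e : G.E) (t : ℝ) : ℝ := max 0 (min t (G.len e))

/-- The point of the realization lying on the edge `e` at coordinate `t`
(the coordinate is clamped into `[0, len e]`). -/
def edgePt (e : G.E) (t : ℝ) : G.Space :=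
  Quot.mk _ ⟨Sum.inr (e, G.clamp e t),
    ⟨le_max_left 0 _, max_le (G.len_pos e).le (min_le_right _ _)⟩⟩

/-- The genus (first Betti number) of the (connected) metric graph. -/
def genus : ℤ := (Fintype.card G.E : ℤ) - (Fintype.card G.V : ℤ) + 1

/-! ### Outgoing directions, valence -/

/-- `d = (e, b)` is an outgoing unit tangent direction at the point `x`:
if `b = true` it points in the direction of increasing coordinate on `e`, if
`b = false` in the direction of decreasing coordinate. -/
def IsDir (x : G.Space) (d : G.E × Bool) : Prop :=
  if d.2 then ∃ t, 0 ≤ t ∧ t < G.len d.1 ∧ x = G.edgePt d.1 t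
  else ∃ t, 0 < t ∧ t ≤ G.len d.1 ∧ x = G.edgePt d.1 t

/-- The (finite) set of outgoing directions at a point. -/
def dirSet (x : G.Space) : Finset (G.E × Bool) :=
  Finset.univ.filter fun d => G.IsDir x d

/-- The valence of a point of the realization: the number of outgoing
directions at that point. -/
def valence (x : G.Space) : ℕ := (G.dirSet x).card

/-- The coordinate on the edge `d.1` of a point `x` admitting `d` as an outgoing
direction. -/
def dirCoord (x : G.Space) (d : G.E × Bool) : ℝ :=
  if d.2 then
    (if h : ∃ t, 0 ≤ t ∧ t < G.len d.1 ∧ x = G.edgePt d.1 t then h.choose else 0)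
  else
    (if h : ∃ t, 0 < t ∧ t ≤ G.len d.1 ∧ x = G.edgePt d.1 t then h.choose else 0)

/-- The point at distance `u` from `x` in the outgoing direction `d`. -/
def dirPt (x : G.Space) (d : G.E × Bool) (u : ℝ) : G.Space :=
  G.edgePt d.1 (G.dirCoord x d + (if d.2 then u else -u))

end CombGraph

/-! ### Rational functions and divisors -/

/-- A function `g : [0, L] → ℝ` is piecewise integral affine if there is a finite
subdivision of `[0, L]` on whose pieces `g` is affine with integral slope. -/
def PWIntAffine (g : ℝ → ℝ) (L : ℝ) : Prop :=
  ∃ (n : ℕ) (t : ℕ → ℝ) (m : ℕ → ℤ) (b : ℕ → ℝ),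
    t 0 = 0 ∧ t n = L ∧ (∀ i, i < n → t i < t (i + 1)) ∧
    (∀ i, i < n → ∀ u, t i ≤ u → u ≤ t (i + 1) → g u = (m i : ℝ) * u + b i)

/-- A rational function on the metric graph realizing `G`: a continuous function
which is piecewise integral affine on every edge. -/
structure RatFn (G : CombGraph) where
  toFun : G.Space → ℝ
  continuous : Continuous toFun
  piecewise : ∀ e : G.E, PWIntAffine (fun t => toFun (G.edgePt e t)) (G.len e)

namespace CombGraph

variable (G : CombGraph)

/-- The right-hand slope of a rational function on the edge `e` at coordinate `t`. -/
def rightSlope (f : RatFn G) (e : G.E) (t : ℝ) : ℝ :=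
  derivWithin (fun u => f.toFun (G.edgePt e u)) (Set.Ici t) t

/-- The left-hand slope of a rational function on the edge `e` at coordinate `t`. -/
def leftSlope (f : RatFn G) (e : G.E) (t : ℝ) : ℝ :=
  derivWithin (fun u => f.toFun (G.edgePt e u)) (Set.Iic t) t

/-- The order of a rational function at a point: the sum of its outgoing slopes. -/
def ordAt (f : RatFn G) (x : G.Space) : ℝ :=
  if h : ∃ v : G.V, x = G.vertexPt v then
    ∑ e : G.E,
      ((if G.src e = h.choose then G.rightSlope f e 0 else 0)
        + (if G.tgt e = h.choose then -(G.leftSlope f e (G.len e)) else 0))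
  else if h2 : ∃ p : G.E × ℝ, 0 < p.2 ∧ p.2 < G.len p.1 ∧ x = G.edgePt p.1 p.2 then
    G.rightSlope f h2.choose.1 h2.choose.2 - G.leftSlope f h2.choose.1 h2.choose.2
  else 0

/-- The group of divisors of the metric graph: the free abelian group on the
points of the realization. -/
abbrev Div (G : CombGraph) : Type := G.Space →₀ ℤ

/-- The degree of a divisor. -/
def degDiv (D : Div G) : ℤ := D.sum fun _ n => n

/-- A divisor is effective if all of its coefficients are nonnegative. -/
def Effective (D : Div G) : Prop := ∀ x, 0 ≤ D x

/-- `D` is the principal divisor associated to the rational function `f`. -/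
def IsPrincipal (D : Div G) (f : RatFn G) : Prop := ∀ x, (D x : ℝ) = G.ordAt f x

/-- Two divisors are linearly equivalent if their difference is principal. -/
def LinEquiv (D D' : Div G) : Prop := ∃ f : RatFn G, G.IsPrincipal (D - D') f

/-- The Baker–Norine rank of a divisor: the largest integer `k` such that for every
effective divisor `E` of degree `k` the linear system `|D - E|` is nonempty.  (For
negative `k` the condition is vacuous, so the supremum is `-1` exactly when
`|D|` is empty.) -/
def Rk (D : Div G) : ℤ :=
  sSup {k : ℤ | ∀ E : Div G, G.Effective E → G.degDiv E = k →
    ∃ E' : Div G, G.Effective E' ∧ G.LinEquiv (D - E) E'}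

/-- A point of a metric graph is a Weierstrass point if `rk(g·[x]) ≥ 1`. -/
def IsWeierstrass (x : G.Space) : Prop :=
  1 ≤ G.Rk (G.genus • Finsupp.single x 1)

/-- The canonical divisor of a metric graph. -/
def canonical : Div G :=
  ∑ v : G.V, ((G.valence (G.vertexPt v) : ℤ) - 2) • Finsupp.single (G.vertexPt v) 1

end CombGraph
/-! ### Tropical admissible covers -/

/-- A tropical admissible cover between the metric graphs realizing `G` and `D`:
a continuous surjective map with finite fibers which is locally integral affine
(witnessed by the data of the image direction `dirMap` and the absolute value
`slope` of the integral slope along every outgoing direction), such that the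
local degree is well defined at every point, and all Riemann–Hurwitz numbers are
nonnegative. -/
structure TropCover (G D : CombGraph) where
  toFun : G.Space → D.Space
  continuous : Continuous toFun
  surjective : Function.Surjective toFun
  finiteFibers : ∀ y : D.Space, (toFun ⁻¹' {y}).Finite
  dirMap : G.Space → G.E × Bool → D.E × Bool
  slope : G.Space → G.E × Bool → ℕ
  localDeg : G.Space → ℕ
  dirMap_isDir : ∀ x d, G.IsDir x d → D.IsDir (toFun x) (dirMap x d)
  locAffine : ∀ x d, G.IsDir x d → ∃ ε > (0 : ℝ), ∀ u, 0 ≤ u → u ≤ ε →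
      toFun (G.dirPt x d u) = D.dirPt (toFun x) (dirMap x d) ((slope x d : ℝ) * u)
  localDeg_spec : ∀ x d', D.IsDir (toFun x) d' →
      localDeg x = ∑ d ∈ (G.dirSet x).filter (fun d => dirMap x d = d'), slope x d
  rh_nonneg : ∀ x, 0 ≤ (G.valence x : ℤ) - 2 - (localDeg x : ℤ) * ((D.valence (toFun x) : ℤ) - 2)

namespace TropCover

variable {G D : CombGraph} (π : TropCover G D)

/-- The fiber of a point as a finite set. -/
def fiber (y : D.Space) : Finset G.Space := (π.finiteFibers y).toFinset

/-- The pullback `π*[y]` of the divisor `[y]`. -/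
def fiberDiv (y : D.Space) : CombGraph.Div G :=
  ∑ z ∈ π.fiber y, (π.localDeg z : ℤ) • Finsupp.single z 1

/-- The pullback morphism on divisors. -/
def pullback (A : CombGraph.Div D) : CombGraph.Div G :=
  A.sum fun y n => n • π.fiberDiv y

/-- The pushforward morphism on divisors. -/
def pushforward (A : CombGraph.Div G) : CombGraph.Div D :=
  Finsupp.mapDomain π.toFun A

/-- The degree of the cover, computed at the point `y` of the target. -/
def degAt (y : D.Space) : ℕ := ∑ z ∈ π.fiber y, π.localDeg z

/-- The Riemann–Hurwitz number of the cover at a point of the source. -/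
def rhNum (x : G.Space) : ℤ :=
  (G.valence x : ℤ) - 2 - (π.localDeg x : ℤ) * ((D.valence (π.toFun x) : ℤ) - 2)

/-- The (finite) set of points where the ramification divisor may be supported:
the vertices of the source together with the fibers of the vertices of the target
(at every other point the Riemann–Hurwitz number vanishes). -/
def ramSupport : Finset G.Space :=
  Finset.univ.image G.vertexPt ∪
    Finset.univ.biUnion fun v : D.V => π.fiber (D.vertexPt v)

/-- The ramification divisor `R_π = Σ_x r_π(x)·[x]` of the cover. -/
def ramDiv : CombGraph.Div G :=
  ∑ x ∈ π.ramSupport, π.rhNum x • Finsupp.single x 1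

end TropCover

/-! ### Piecewise integral affine functions on intervals -/

namespace PWIntAffine

lemma zero (g : ℝ → ℝ) : PWIntAffine g 0 :=
  ⟨0, fun _ => 0, fun _ => 0, fun _ => 0, rfl, rfl, by simp, by simp⟩

/-- A piecewise integral affine function can be extended by one further affine piece. -/
lemma extend {g : ℝ → ℝ} {s s' : ℝ} (h : PWIntAffine g s) (hs : s < s') (m : ℤ) (b : ℝ)
    (hg : ∀ u, s ≤ u → u ≤ s' → g u = m * u + b) : PWIntAffine g s' := by
  obtain ⟨n, t, k, c, h0, hn, hlt, haff⟩ := h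
  refine ⟨n + 1, fun i => if i ≤ n then t i else s', fun i => if i < n then k i else m,
    fun i => if i < n then c i else b, by simp [h0], by simp, ?_, ?_⟩
  · intro i hi
    rcases Nat.lt_succ_iff_lt_or_eq.mp hi with h | rfl
    · simpa [h.le, Nat.succ_le_of_lt h] using hlt i h
    · simpa [hn] using hs
  · intro i hi u hu hu'
    rcases Nat.lt_succ_iff_lt_or_eq.mp hi with h | rfl
    · simp only [h.le, Nat.succ_le_of_lt h, if_true] at hu hu'
      simpa [h] using haff i h u hu hu'
    · simp only [le_refl, if_true, hn] at hu
      simp at hu'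
      simpa using hg u hu hu'

/-- A function on `[0, L]` which is integral affine on both sides of every point is
piecewise integral affine. -/
lemma of_local {g : ℝ → ℝ} {L : ℝ} (hL : 0 < L)
    (hr : ∀ t, 0 ≤ t → t < L → ∃ ε > (0 : ℝ), ∃ (m : ℤ) (b : ℝ),
      ∀ u, t ≤ u → u ≤ t + ε → g u = m * u + b)
    (hl : ∀ t, 0 < t → t ≤ L → ∃ ε > (0 : ℝ), ∃ (m : ℤ) (b : ℝ),
      ∀ u, t - ε ≤ u → u ≤ t → g u = m * u + b) : PWIntAffine g L := by
  set S : Set ℝ := {s | 0 ≤ s ∧ s ≤ L ∧ PWIntAffine g s} with hS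
  have h0S : (0 : ℝ) ∈ S := ⟨le_rfl, hL.le, zero g⟩
  have hbdd : BddAbove S := ⟨L, fun s hs => hs.2.1⟩
  have hs0 : 0 ≤ sSup S := le_csSup hbdd h0S
  have hsL : sSup S ≤ L := csSup_le ⟨0, h0S⟩ fun s hs => hs.2.1
  have hpw : PWIntAffine g (sSup S) := by
    rcases hs0.eq_or_lt with h | h
    · rw [← h]; exact zero g
    · obtain ⟨ε, hε, m, b, hg⟩ := hl _ h hsL
      obtain ⟨s, hs, hlt⟩ := exists_lt_of_lt_csSup ⟨0, h0S⟩ (sub_lt_self (sSup S) hε)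
      rcases (le_csSup hbdd hs).eq_or_lt with h' | h'
      · rw [← h']; exact hs.2.2
      · exact hs.2.2.extend h' m b fun u hu hu' => hg u (hlt.le.trans hu) hu'
  rcases hsL.eq_or_lt with h | h
  · rwa [← h]
  · exfalso
    obtain ⟨ε, hε, m, b, hg⟩ := hr _ hs0 h
    have hlt : sSup S < min (sSup S + ε) L := lt_min (by linarith) h
    have : min (sSup S + ε) L ∈ S := ⟨hs0.trans hlt.le, min_le_right _ _,
      hpw.extend hlt m b fun u hu hu' => hg u hu (hu'.trans (min_le_left _ _))⟩
    exact absurd (le_csSup hbdd this) (not_le.mpr hlt)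

lemma exists_right {g : ℝ → ℝ} {L : ℝ} (h : PWIntAffine g L) {t : ℝ} (ht0 : 0 ≤ t)
    (htL : t < L) : ∃ ε > (0 : ℝ), ∃ m : ℤ, ∀ u, 0 ≤ u → u ≤ ε → g (t + u) = g t + m * u := by
  obtain ⟨n, s, k, c, h0, hn, -, haff⟩ := h
  have hex : ∃ i, t < s i := ⟨n, hn ▸ htL⟩
  obtain ⟨i, hi⟩ : ∃ i, Nat.find hex = i + 1 := Nat.exists_eq_succ_of_ne_zero fun h => by
    have := Nat.find_spec hex
    rw [h, h0] at this
    linarith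
  have hlt : t < s (i + 1) := hi ▸ Nat.find_spec hex
  have hle : s i ≤ t := not_lt.mp (Nat.find_min hex (by omega))
  have hin : i < n := by
    have := Nat.find_min' hex (hn ▸ htL : t < s n)
    omega
  refine ⟨s (i + 1) - t, by linarith, k i, fun u hu hu' => ?_⟩
  rw [haff i hin _ (by linarith) (by linarith), haff i hin t hle hlt.le]
  ring

lemma exists_left {g : ℝ → ℝ} {L : ℝ} (h : PWIntAffine g L) {t : ℝ} (ht0 : 0 < t)
    (htL : t ≤ L) : ∃ ε > (0 : ℝ), ∃ m : ℤ, ∀ u, 0 ≤ u → u ≤ ε → g (t - u) = g t + m * u := by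
  obtain ⟨n, s, k, c, h0, hn, -, haff⟩ := h
  have hex : ∃ i, t ≤ s i := ⟨n, hn ▸ htL⟩
  obtain ⟨i, hi⟩ : ∃ i, Nat.find hex = i + 1 := Nat.exists_eq_succ_of_ne_zero fun h => by
    have := Nat.find_spec hex
    rw [h, h0] at this
    linarith
  have hle : t ≤ s (i + 1) := hi ▸ Nat.find_spec hex
  have hlt : s i < t := not_le.mp (Nat.find_min hex (by omega))
  have hin : i < n := by
    have := Nat.find_min' hex (hn ▸ htL : t ≤ s n)
    omega
  refine ⟨t - s i, by linarith, -k i, fun u hu hu' => ?_⟩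
  rw [haff i hin _ (by linarith) (by linarith), haff i hin t hlt.le hle]
  push_cast
  ring

end PWIntAffine

namespace CombGraph

variable {G : CombGraph}

/-! ### Points of the realization -/

/-- The normal form of a point: the vertex it is, or its edge and interior coordinate. -/
def normalForm (G : CombGraph) : G.Space → G.V ⊕ (G.E × ℝ) :=
  Quot.lift
    (fun p => match p.1 with
      | Sum.inl v => Sum.inl v
      | Sum.inr (e, t) =>
        if t = 0 then Sum.inl (G.src e) else if t = G.len e then Sum.inl (G.tgt e)
        else Sum.inr (e, t))
    (by
      rintro _ _ (e | e)
      · simp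
      · simp [(G.len_pos e).ne'])

lemma clamp_of_mem {e : G.E} {t : ℝ} (h0 : 0 ≤ t) (hL : t ≤ G.len e) : G.clamp e t = t := by
  simp [clamp, h0, hL]

lemma normalForm_vertexPt (v : G.V) : G.normalForm (G.vertexPt v) = Sum.inl v := rfl

lemma normalForm_edgePt (e : G.E) (t : ℝ) : G.normalForm (G.edgePt e t) =
    if G.clamp e t = 0 then Sum.inl (G.src e)
    else if G.clamp e t = G.len e then Sum.inl (G.tgt e) else Sum.inr (e, G.clamp e t) := rfl

lemma normalForm_edgePt_of_mem {e : G.E} {t : ℝ} (h0 : 0 < t) (hL : t < G.len e) :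
    G.normalForm (G.edgePt e t) = Sum.inr (e, t) := by
  rw [normalForm_edgePt, clamp_of_mem h0.le hL.le, if_neg h0.ne', if_neg hL.ne]

lemma vertexPt_injective : Function.Injective G.vertexPt := fun v w h => by
  simpa [normalForm_vertexPt] using congrArg G.normalForm h

lemma edgePt_zero (e : G.E) : G.edgePt e 0 = G.vertexPt (G.src e) := by
  refine Eq.trans ?_ (Quot.sound (Glue.srcGlue e)).symm
  simp only [edgePt, clamp_of_mem le_rfl (G.len_pos e).le]
  rfl

lemma edgePt_len (e : G.E) : G.edgePt e (G.len e) = G.vertexPt (G.tgt e) := by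
  refine Eq.trans ?_ (Quot.sound (Glue.tgtGlue e)).symm
  simp only [edgePt, clamp_of_mem (G.len_pos e).le le_rfl]
  rfl

lemma edgePt_ne_vertexPt {e : G.E} {t : ℝ} (h0 : 0 < t) (hL : t < G.len e) (v : G.V) :
    G.edgePt e t ≠ G.vertexPt v := fun h => by
  have := congrArg G.normalForm h
  rw [normalForm_edgePt_of_mem h0 hL, normalForm_vertexPt] at this
  cases this

/-- Every point is a vertex or an interior point of an edge. -/
lemma exists_rep (x : G.Space) : (∃ v, x = G.vertexPt v) ∨
    ∃ e t, 0 < t ∧ t < G.len e ∧ x = G.edgePt e t := by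
  obtain ⟨⟨p, hp⟩, rfl⟩ := Quot.exists_rep x
  rcases p with v | ⟨e, t⟩
  · exact Or.inl ⟨v, rfl⟩
  · have hx : Quot.mk G.Glue ⟨Sum.inr (e, t), hp⟩ = G.edgePt e t := by
      simp only [edgePt, clamp_of_mem hp.1 hp.2]
    rw [hx]
    rcases hp.1.eq_or_lt with h | h
    · exact Or.inl ⟨_, by rw [show t = 0 from h.symm]; exact edgePt_zero e⟩
    · rcases hp.2.eq_or_lt with h' | h'
      · exact Or.inl ⟨_, by rw [show t = G.len e from h']; exact edgePt_len e⟩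
      · exact Or.inr ⟨e, t, h, h', rfl⟩

lemma edgePt_inj_of_lt {e : G.E} {s t : ℝ} (hs : 0 ≤ s) (hs' : s < G.len e) (ht : 0 ≤ t)
    (ht' : t < G.len e) (h : G.edgePt e s = G.edgePt e t) : s = t := by
  rcases hs.eq_or_lt with rfl | hs
  · rcases ht.eq_or_lt with rfl | ht
    · rfl
    · rw [edgePt_zero] at h
      exact absurd h.symm (edgePt_ne_vertexPt ht ht' _)
  · rcases ht.eq_or_lt with rfl | ht
    · rw [edgePt_zero] at h
      exact absurd h (edgePt_ne_vertexPt hs hs' _)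
    · have := congrArg G.normalForm h
      rw [normalForm_edgePt_of_mem hs hs', normalForm_edgePt_of_mem ht ht'] at this
      simpa using this

lemma edgePt_inj_of_pos {e : G.E} {s t : ℝ} (hs : 0 < s) (hs' : s ≤ G.len e) (ht : 0 < t)
    (ht' : t ≤ G.len e) (h : G.edgePt e s = G.edgePt e t) : s = t := by
  rcases hs'.eq_or_lt with rfl | hs'
  · rcases ht'.eq_or_lt with rfl | ht'
    · rfl
    · rw [edgePt_len] at h
      exact absurd h.symm (edgePt_ne_vertexPt ht ht' _)
  · rcases ht'.eq_or_lt with rfl | ht'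
    · rw [edgePt_len] at h
      exact absurd h (edgePt_ne_vertexPt hs hs' _)
    · exact edgePt_inj_of_lt hs.le hs' ht.le ht' h

/-! ### Directions -/

lemma isDir_true {x : G.Space} {e : G.E} :
    G.IsDir x (e, true) ↔ ∃ t, 0 ≤ t ∧ t < G.len e ∧ x = G.edgePt e t := by
  simp [IsDir]

lemma isDir_false {x : G.Space} {e : G.E} :
    G.IsDir x (e, false) ↔ ∃ t, 0 < t ∧ t ≤ G.len e ∧ x = G.edgePt e t := by
  simp [IsDir]

lemma dirPt_true {e : G.E} {t : ℝ} (h0 : 0 ≤ t) (hL : t < G.len e) (u : ℝ) :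
    G.dirPt (G.edgePt e t) (e, true) u = G.edgePt e (t + u) := by
  have h : ∃ s, 0 ≤ s ∧ s < G.len e ∧ G.edgePt e t = G.edgePt e s := ⟨t, h0, hL, rfl⟩
  have hc : G.dirCoord (G.edgePt e t) (e, true) = t := by
    simp only [dirCoord, if_true]
    rw [dif_pos h]
    exact (edgePt_inj_of_lt h0 hL h.choose_spec.1 h.choose_spec.2.1 h.choose_spec.2.2).symm
  simp [dirPt, hc]

lemma dirPt_false {e : G.E} {t : ℝ} (h0 : 0 < t) (hL : t ≤ G.len e) (u : ℝ) :
    G.dirPt (G.edgePt e t) (e, false) u = G.edgePt e (t - u) := by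
  have h : ∃ s, 0 < s ∧ s ≤ G.len e ∧ G.edgePt e t = G.edgePt e s := ⟨t, h0, hL, rfl⟩
  have hc : G.dirCoord (G.edgePt e t) (e, false) = t := by
    simp only [dirCoord, Bool.false_eq_true, if_false]
    rw [dif_pos h]
    exact (edgePt_inj_of_pos h0 hL h.choose_spec.1 h.choose_spec.2.1 h.choose_spec.2.2).symm
  simp [dirPt, hc, sub_eq_add_neg]

lemma isDir_vertexPt_true {v : G.V} {e : G.E} :
    G.IsDir (G.vertexPt v) (e, true) ↔ G.src e = v := by
  rw [isDir_true]
  constructor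
  · rintro ⟨t, h0, hL, h⟩
    rcases h0.eq_or_lt with rfl | h0
    · rw [edgePt_zero] at h
      exact (vertexPt_injective h).symm
    · exact absurd h.symm (edgePt_ne_vertexPt h0 hL v)
  · rintro rfl
    exact ⟨0, le_rfl, G.len_pos e, (edgePt_zero e).symm⟩

lemma isDir_vertexPt_false {v : G.V} {e : G.E} :
    G.IsDir (G.vertexPt v) (e, false) ↔ G.tgt e = v := by
  rw [isDir_false]
  constructor
  · rintro ⟨t, h0, hL, h⟩
    rcases hL.eq_or_lt with rfl | hL
    · rw [edgePt_len] at h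
      exact (vertexPt_injective h).symm
    · exact absurd h.symm (edgePt_ne_vertexPt h0 hL v)
  · rintro rfl
    exact ⟨G.len e, G.len_pos e, le_rfl, (edgePt_len e).symm⟩

lemma eq_of_edgePt_eq {e e' : G.E} {s t : ℝ} (h0 : 0 < t) (hL : t < G.len e) (hs : 0 ≤ s)
    (hs' : s ≤ G.len e') (h : G.edgePt e t = G.edgePt e' s) : e' = e ∧ s = t := by
  rcases hs.eq_or_lt with rfl | hs
  · exact absurd (h.trans (edgePt_zero e')) (edgePt_ne_vertexPt h0 hL _)
  · rcases hs'.eq_or_lt with rfl | hs'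
    · exact absurd (h.trans (edgePt_len e')) (edgePt_ne_vertexPt h0 hL _)
    · have := congrArg G.normalForm h
      rw [normalForm_edgePt_of_mem hs hs', normalForm_edgePt_of_mem h0 hL] at this
      simpa [eq_comm] using this

lemma dirSet_edgePt {e : G.E} {t : ℝ} (h0 : 0 < t) (hL : t < G.len e) :
    G.dirSet (G.edgePt e t) = {(e, true), (e, false)} := by
  ext ⟨e', b⟩
  cases b
  · simp only [dirSet, Finset.mem_filter, Finset.mem_univ, true_and, isDir_false]
    constructor
    · rintro ⟨s, hs, hs', h⟩
      simp [(eq_of_edgePt_eq h0 hL hs.le hs' h).1]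
    · intro h
      obtain rfl : e' = e := by simpa using h
      exact ⟨t, h0, hL.le, rfl⟩
  · simp only [dirSet, Finset.mem_filter, Finset.mem_univ, true_and, isDir_true]
    constructor
    · rintro ⟨s, hs, hs', h⟩
      simp [(eq_of_edgePt_eq h0 hL hs hs'.le h).1]
    · intro h
      obtain rfl : e' = e := by simpa using h
      exact ⟨t, h0.le, hL, rfl⟩

/-! ### Outgoing slopes -/

/-- The function `h` is affine near `x` in the direction `d`, with outgoing slope `m`. -/
def HasOutSlope (h : G.Space → ℝ) (x : G.Space) (d : G.E × Bool) (m : ℝ) : Prop :=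
  ∃ ε > (0 : ℝ), ∀ u, 0 ≤ u → u ≤ ε → h (G.dirPt x d u) = h x + m * u

lemma hasOutSlope_true {h : G.Space → ℝ} {e : G.E} {t m : ℝ} (h0 : 0 ≤ t) (hL : t < G.len e) :
    HasOutSlope h (G.edgePt e t) (e, true) m ↔
      ∃ ε > (0 : ℝ), ∀ u, 0 ≤ u → u ≤ ε → h (G.edgePt e (t + u)) = h (G.edgePt e t) + m * u := by
  simp only [HasOutSlope, dirPt_true h0 hL]

lemma hasOutSlope_false {h : G.Space → ℝ} {e : G.E} {t m : ℝ} (h0 : 0 < t) (hL : t ≤ G.len e) :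
    HasOutSlope h (G.edgePt e t) (e, false) m ↔
      ∃ ε > (0 : ℝ), ∀ u, 0 ≤ u → u ≤ ε → h (G.edgePt e (t - u)) = h (G.edgePt e t) + m * u := by
  simp only [HasOutSlope, dirPt_false h0 hL]

/-- A rational function has an integral outgoing slope in every direction. -/
lemma exists_hasOutSlope (f : RatFn G) {x : G.Space} {d : G.E × Bool} (hd : G.IsDir x d) :
    ∃ m : ℤ, HasOutSlope f.toFun x d m := by
  obtain ⟨e, b⟩ := d
  cases b
  · obtain ⟨t, h0, hL, rfl⟩ := isDir_false.mp hd
    obtain ⟨ε, hε, m, hm⟩ := (f.piecewise e).exists_left h0 hL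
    exact ⟨m, (hasOutSlope_false h0 hL).mpr ⟨ε, hε, hm⟩⟩
  · obtain ⟨t, h0, hL, rfl⟩ := isDir_true.mp hd
    obtain ⟨ε, hε, m, hm⟩ := (f.piecewise e).exists_right h0 hL
    exact ⟨m, (hasOutSlope_true h0 hL).mpr ⟨ε, hε, hm⟩⟩

/-- A function with integral outgoing slopes is piecewise integral affine on every edge. -/
lemma pwIntAffine_of_hasOutSlope {h : G.Space → ℝ}
    (hh : ∀ x d, G.IsDir x d → ∃ m : ℤ, HasOutSlope h x d m) (e : G.E) :
    PWIntAffine (fun t => h (G.edgePt e t)) (G.len e) := by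
  refine PWIntAffine.of_local (G.len_pos e) (fun t h0 hL => ?_) (fun t h0 hL => ?_)
  · obtain ⟨m, hm⟩ := hh _ _ (isDir_true.mpr ⟨t, h0, hL, rfl⟩)
    obtain ⟨ε, hε, hm⟩ := (hasOutSlope_true h0 hL).mp hm
    refine ⟨ε, hε, m, h (G.edgePt e t) - m * t, fun u hu hu' => ?_⟩
    have := hm (u - t) (by linarith) (by linarith)
    rw [add_sub_cancel] at this
    rw [this]
    ring
  · obtain ⟨m, hm⟩ := hh _ _ (isDir_false.mpr ⟨t, h0, hL, rfl⟩)
    obtain ⟨ε, hε, hm⟩ := (hasOutSlope_false h0 hL).mp hm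
    refine ⟨ε, hε, -m, h (G.edgePt e t) + m * t, fun u hu hu' => ?_⟩
    have := hm (t - u) (by linarith) (by linarith)
    rw [sub_sub_cancel] at this
    rw [this]
    push_cast
    ring

lemma rightSlope_eq (f : RatFn G) {e : G.E} {t m : ℝ} (h0 : 0 ≤ t) (hL : t < G.len e)
    (hm : HasOutSlope f.toFun (G.edgePt e t) (e, true) m) : G.rightSlope f e t = m := by
  obtain ⟨ε, hε, hm⟩ := (hasOutSlope_true h0 hL).mp hm
  have hlin : HasDerivWithinAt (fun u => f.toFun (G.edgePt e t) + m * (u - t)) m (Set.Ici t) t := by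
    simpa using ((((hasDerivAt_id t).sub_const t).const_mul m).const_add
      (f.toFun (G.edgePt e t))).hasDerivWithinAt
  refine (hlin.congr_of_eventuallyEq ?_ (by simp)).derivWithin (uniqueDiffWithinAt_Ici t)
  filter_upwards [Icc_mem_nhdsGE (lt_add_of_pos_right t hε)] with u hu
  have := hm (u - t) (by linarith [hu.1]) (by linarith [hu.2])
  rwa [add_sub_cancel] at this

lemma leftSlope_eq (f : RatFn G) {e : G.E} {t m : ℝ} (h0 : 0 < t) (hL : t ≤ G.len e)
    (hm : HasOutSlope f.toFun (G.edgePt e t) (e, false) m) : G.leftSlope f e t = -m := by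
  obtain ⟨ε, hε, hm⟩ := (hasOutSlope_false h0 hL).mp hm
  have hlin : HasDerivWithinAt (fun u => f.toFun (G.edgePt e t) + -m * (u - t)) (-m)
      (Set.Iic t) t := by
    simpa using ((((hasDerivAt_id t).sub_const t).const_mul (-m)).const_add
      (f.toFun (G.edgePt e t))).hasDerivWithinAt
  refine (hlin.congr_of_eventuallyEq ?_ (by simp)).derivWithin (uniqueDiffWithinAt_Iic t)
  filter_upwards [Icc_mem_nhdsLE (sub_lt_self t hε)] with u hu
  have := hm (t - u) (by linarith [hu.2]) (by linarith [hu.1])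
  rw [sub_sub_cancel] at this
  rw [this]
  ring

/-- The order of a rational function is the sum of its slopes along all outgoing directions. -/
lemma ordAt_eq_sum (f : RatFn G) (x : G.Space) (m : G.E × Bool → ℝ)
    (hm : ∀ d, G.IsDir x d → HasOutSlope f.toFun x d (m d)) :
    G.ordAt f x = ∑ d ∈ G.dirSet x, m d := by
  rcases exists_rep x with hv | ⟨e, t, h0, hL, rfl⟩
  · rw [ordAt, dif_pos hv]
    have hx := hv.choose_spec
    generalize hv.choose = v at hx
    subst hx
    rw [dirSet, Finset.sum_filter, Fintype.sum_prod_type]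
    refine Finset.sum_congr rfl fun e _ => ?_
    rw [Fintype.sum_bool]
    simp only [isDir_vertexPt_true, isDir_vertexPt_false]
    congr 1
    · refine ite_congr rfl (fun h => ?_) fun _ => rfl
      refine rightSlope_eq f le_rfl (G.len_pos e) ?_
      rw [edgePt_zero, h]
      exact hm _ (isDir_vertexPt_true.mpr h)
    · refine ite_congr rfl (fun h => ?_) fun _ => rfl
      rw [leftSlope_eq f (G.len_pos e) le_rfl (m := m (e, false)), neg_neg]
      rw [edgePt_len, h]
      exact hm _ (isDir_vertexPt_false.mpr h)
  · have hv : ¬ ∃ v, G.edgePt e t = G.vertexPt v := fun ⟨v, h⟩ => edgePt_ne_vertexPt h0 hL v h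
    have hp : ∃ p : G.E × ℝ, 0 < p.2 ∧ p.2 < G.len p.1 ∧ G.edgePt e t = G.edgePt p.1 p.2 :=
      ⟨(e, t), h0, hL, rfl⟩
    rw [ordAt, dif_neg hv, dif_pos hp]
    obtain ⟨h1, h2, h3⟩ := hp.choose_spec
    obtain ⟨h4, h5⟩ := eq_of_edgePt_eq h0 hL h1.le h2.le h3
    rw [h4, h5, dirSet_edgePt h0 hL, Finset.sum_pair (by simp),
      rightSlope_eq f h0.le hL (hm _ (isDir_true.mpr ⟨t, h0.le, hL, rfl⟩)),
      leftSlope_eq f h0 hL.le (hm _ (isDir_false.mpr ⟨t, h0, hL.le, rfl⟩)), sub_neg_eq_add]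

/-- Outgoing slopes get multiplied by the dilation factor of the cover. -/
lemma HasOutSlope.comp {D : CombGraph} (π : TropCover G D) {f : D.Space → ℝ} {x : G.Space}
    {d : G.E × Bool} {m : ℝ} (hd : G.IsDir x d)
    (hf : HasOutSlope f (π.toFun x) (π.dirMap x d) m) :
    HasOutSlope (f ∘ π.toFun) x d (π.slope x d * m) := by
  obtain ⟨δ, hδ, hf⟩ := hf
  obtain ⟨ε, hε, hπ⟩ := π.locAffine x d hd
  have hk : (0 : ℝ) < π.slope x d + 1 := by positivity
  refine ⟨min ε (δ / (π.slope x d + 1)), by positivity, fun u hu hu' => ?_⟩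
  have hu'' := (le_div_iff₀ hk).mp (hu'.trans (min_le_right _ _))
  rw [Function.comp_apply, hπ u hu (hu'.trans (min_le_left _ _)),
    hf _ (by positivity) (by linarith), Function.comp_apply]
  ring

end CombGraph

/-- for a tropical admissible cover `π : Γ → Δ` and a rational
function `f` on `Δ`, the composition `f ∘ π` is a rational function on `Γ` and
`π* div(f) = div(f ∘ π)`, i.e. `ord_y (f ∘ π) = d_π(y) · ord_{π(y)} f` for all `y`. -/
theorem pullback_of_rational (Γ Δ : CombGraph)
    (hΓc : CompactSpace Γ.Space) (hΓ : ConnectedSpace Γ.Space)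
    (hΔc : CompactSpace Δ.Space) (hΔ : ConnectedSpace Δ.Space)
    (π : TropCover Γ Δ) (f : RatFn Δ) :
    ∃ g : RatFn Γ, g.toFun = f.toFun ∘ π.toFun ∧
      ∀ y : Γ.Space, Γ.ordAt g y = (π.localDeg y : ℝ) * Δ.ordAt f (π.toFun y) := by
  have hslope : ∀ x d, Γ.IsDir x d →
      ∃ m : ℤ, CombGraph.HasOutSlope (f.toFun ∘ π.toFun) x d m := fun x d hd => by
    obtain ⟨m, hm⟩ := CombGraph.exists_hasOutSlope f (π.dirMap_isDir x d hd)
    exact ⟨π.slope x d * m, by simpa using hm.comp π hd⟩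
  refine ⟨⟨f.toFun ∘ π.toFun, f.continuous.comp π.continuous,
    CombGraph.pwIntAffine_of_hasOutSlope hslope⟩, rfl, fun y => ?_⟩
  choose! m hm using fun d' (hd' : Δ.IsDir (π.toFun y) d') => CombGraph.exists_hasOutSlope f hd'
  rw [CombGraph.ordAt_eq_sum f _ (fun d' => m d') hm,
    CombGraph.ordAt_eq_sum _ y (fun d => π.slope y d * m (π.dirMap y d))
      fun d hd => (hm _ (π.dirMap_isDir y d hd)).comp π hd,
    ← Finset.sum_fiberwise_of_maps_to (s := Γ.dirSet y) (t := Δ.dirSet (π.toFun y))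
      (g := π.dirMap y) fun d hd => by
        simpa [CombGraph.dirSet] using π.dirMap_isDir y d (by simpa [CombGraph.dirSet] using hd),
    Finset.mul_sum]
  refine Finset.sum_congr rfl fun d' hd' => ?_
  rw [π.localDeg_spec y d' (by simpa [CombGraph.dirSet] using hd'), Nat.cast_sum, Finset.sum_mul]
  refine Finset.sum_congr rfl fun d hd => ?_
  rw [(Finset.mem_filter.mp hd).2]
end
end
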